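/- Let 𝔇 = (S, s₀, K, 𝔓) be a family of MCs, let r ∈ R^𝔇 be a realisation, and let G ⊆ S. In the all-in-one MDP M^𝔇, consider the memoryless deterministic scheduler that selects action a_r at the fresh initial state 'none' (and the unique enabled action elsewhere). Then the reachability probability, in the trajectory measure of the induced MC started at 'none', of the lifted goal set {some (s, r') | s ∈ G, r' ∈ R^𝔇} equals Prob(D_r, ◇G), the reachability probability of G in the Markov chain D_r started at s₀. -/

import Mathlib

open MeasureTheory
open scoped ENNReal NNReal Classical

/-- A family of Markov chains `𝔇 = (S, s₀, K, 𝔓)`: finite state space `S`,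
initial state `s₀`, finite parameter set `K` with nonempty finite domains `T k ⊆ S`,
and a parametric transition function `𝔓 : S → Distr(K)`. -/
structure MCFamily (S K : Type) [Fintype S] [Fintype K] where
  s0 : S
  T : K → Finset S
  T_nonempty : ∀ k, (T k).Nonempty
  P : S → PMF K

variable {S K : Type} [Fintype S] [Fintype K]

/-- The set `R^𝔇` of realisations of the family. -/
def Realisations (𝔇 : MCFamily S K) : Set (K → S) :=
  {r | ∀ k, r k ∈ 𝔇.T k}

/-- Transition matrix of the Markov chain `D_r` induced by realisation `r`:
at state `s` it is the pushforward of `𝔓(s)` under `r`. -/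
noncomputable def familyTrans (𝔇 : MCFamily S K) (r : K → S) (s : S) : PMF S :=
  (𝔇.P s).map r

/-- The `k`-th binary digit of the fractional part of `u`. -/
noncomputable def bit (k : ℕ) (u : ℝ) : ℕ := ⌊u * 2 ^ (k + 1)⌋.toNat % 2

/-- From one uniform `u ∈ [0,1)`, extract the `i`-th member of an i.i.d. sequence of
uniform random variables, by de-interleaving binary digits. -/
noncomputable def uSlice (i : ℕ) (u : ℝ) : ℝ :=
  ∑' k : ℕ, (bit (Nat.pair i k) u : ℝ) / 2 ^ (k + 1)

/-- Cumulative distribution values of a PMF on a finite type, w.r.t. a fixed enumeration. -/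
noncomputable def cumul {σ : Type} [Fintype σ] (P : PMF σ) (j : ℕ) : ℝ :=
  ∑ i ∈ Finset.univ.filter (fun i : Fin (Fintype.card σ) => (i : ℕ) < j),
    (P ((Fintype.equivFin σ).symm i)).toReal

/-- Inverse-CDF sampling: if `u` is uniform on `[0,1)` then `sample P u` has law `P`. -/
noncomputable def sample {σ : Type} [Fintype σ] [Nonempty σ] (P : PMF σ) (u : ℝ) : σ :=
  (Fintype.equivFin σ).symm <|
    if h : (Finset.univ.filter fun j : Fin (Fintype.card σ) =>
        u < cumul P ((j : ℕ) + 1)).Nonempty then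
      (Finset.univ.filter fun j : Fin (Fintype.card σ) =>
        u < cumul P ((j : ℕ) + 1)).min' h
    else ⟨0, Fintype.card_pos⟩

/-- Simulation of the Markov chain with transition function `P` started in `init`,
driven by the i.i.d. uniform sequence extracted from `u`. -/
noncomputable def simTraj {σ : Type} [Fintype σ] [Nonempty σ]
    (P : σ → PMF σ) (init : σ) (u : ℝ) : ℕ → σ
  | 0 => init
  | n + 1 => sample (P (simTraj P init u n)) (uSlice n u)

/-- The law of the trajectories (`ℕ → σ` with the product of discrete σ-algebras) of the
Markov chain with transition function `P` and initial distribution `δ_init`; it is obtained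
as the pushforward of the uniform distribution on `[0,1)` under the simulation map, which
coincides with the measure given by the Ionescu–Tulcea construction. -/
noncomputable def trajMeasure {σ : Type} [Fintype σ] [Nonempty σ]
    (P : σ → PMF σ) (init : σ) :
    @Measure (ℕ → σ) (@MeasurableSpace.pi ℕ (fun _ => σ) (fun _ => ⊤)) :=
  @Measure.map ℝ (ℕ → σ) _ (@MeasurableSpace.pi ℕ (fun _ => σ) (fun _ => ⊤))
    (simTraj P init) ((volume : Measure ℝ).restrict (Set.Ico 0 1))

/-- Reachability probability `Prob(·, ◇G)`. -/
noncomputable def reachProb {σ : Type} [Fintype σ] [Nonempty σ]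
    (P : σ → PMF σ) (init : σ) (G : Set σ) : ℝ≥0∞ :=
  trajMeasure P init {ω | ∃ n, ω n ∈ G}

/-- Expected reward accumulated before reaching `G`. -/
noncomputable def expReward {σ : Type} [Fintype σ] [Nonempty σ]
    (P : σ → PMF σ) (init : σ) (G : Set σ) (rew : σ → ℝ≥0) : ℝ≥0∞ :=
  ∫⁻ ω, (∑' n : ℕ, if ∀ m ≤ n, ω m ∉ G then (rew (ω n) : ℝ≥0∞) else 0)
    ∂(trajMeasure P init)

/-- The (sub)type of realisations of the family `𝔇`. -/
abbrev Realz (𝔇 : MCFamily S K) := {r : K → S // ∀ k, r k ∈ 𝔇.T k}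

/-- Transition function of the Markov chain induced on the all-in-one MDP `M^𝔇`
(state space `Option (S × R^𝔇)`, fresh initial state `none`) by the memoryless
deterministic scheduler that selects action `a_r` at `none` (elsewhere only one action
is enabled): from `none` move surely to `some (s₀, r)`; from `some (s, r')` move to
`some (s', r')` with probability `𝔓(r')(s)(s')`. -/
noncomputable def allInOneTrans [DecidableEq S] [DecidableEq K] (𝔇 : MCFamily S K)
    (r : Realz 𝔇) : Option (S × Realz 𝔇) → PMF (Option (S × Realz 𝔇))
  | none => PMF.pure (some (𝔇.s0, r))
  | some (s, r') => ((𝔇.P s).map r'.val).map fun s' => some (s', r')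

/-- The lifted goal set `{some (s, r') | s ∈ G, r' ∈ R^𝔇}` in the all-in-one MDP. -/
def liftedGoal [DecidableEq S] [DecidableEq K] (𝔇 : MCFamily S K) (G : Set S) :
    Set (Option (S × Realz 𝔇)) :=
  {x | ∃ s ∈ G, ∃ r' : Realz 𝔇, x = some (s, r')}

open ProbabilityTheory

/-! ### Binary digits of a uniform variable are i.i.d. fair coins -/

/-- The uniform distribution on `[0, 1)`. -/
noncomputable def unitUniform : Measure ℝ := (volume : Measure ℝ).restrict (Set.Ico 0 1)

instance : IsProbabilityMeasure unitUniform := ⟨by simp [unitUniform]⟩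

/-- The fair coin, as a measure on `ℕ` charging `0` and `1`. -/
noncomputable def fairCoin : Measure ℕ := (2⁻¹ : ℝ≥0∞) • (Measure.dirac 0 + Measure.dirac 1)

instance : IsProbabilityMeasure fairCoin :=
  ⟨by simp [fairCoin, ENNReal.inv_two_add_inv_two]⟩

lemma fairCoin_singleton (b : ℕ) : fairCoin {b} = if b < 2 then 2⁻¹ else 0 := by
  rcases b with _ | _ | b <;> simp [fairCoin]

lemma bit_eq_natFloor (k : ℕ) (u : ℝ) : bit k u = ⌊u * 2 ^ (k + 1)⌋₊ % 2 := rfl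

lemma measurable_bit (k : ℕ) : Measurable (bit k) := by
  have h : Measurable fun u : ℝ => ⌊u * 2 ^ (k + 1)⌋₊ :=
    Nat.measurable_floor.comp (measurable_id.mul_const _)
  exact (measurable_from_nat (f := fun n => n % 2)).comp h

lemma natFloor_mul_two_pow_div_two (u : ℝ) (n : ℕ) :
    ⌊u * 2 ^ (n + 1)⌋₊ / 2 = ⌊u * 2 ^ n⌋₊ := by
  rw [← Nat.floor_div_ofNat]
  congr 1
  rw [pow_succ]
  field_simp

lemma unitUniform_natFloor_eq {n m : ℕ} (hm : m < 2 ^ n) :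
    unitUniform {u | ⌊u * 2 ^ n⌋₊ = m} = 2⁻¹ ^ n := by
  have hpow : (0 : ℝ) < 2 ^ n := by positivity
  have hm' : (m : ℝ) + 1 ≤ 2 ^ n := by exact_mod_cast hm
  have hset : {u : ℝ | ⌊u * 2 ^ n⌋₊ = m} ∩ Set.Ico 0 1
      = Set.Ico (m / 2 ^ n : ℝ) ((m + 1) / 2 ^ n) := by
    ext u
    simp only [Set.mem_inter_iff, Set.mem_ofPred_eq, Set.mem_Ico]
    rw [div_le_iff₀ hpow, lt_div_iff₀ hpow]
    constructor
    · rintro ⟨h, h0, -⟩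
      exact (Nat.floor_eq_iff (by positivity)).1 h
    · rintro ⟨h1, h2⟩
      have h0 : 0 ≤ u := nonneg_of_mul_nonneg_left ((Nat.cast_nonneg m).trans h1) hpow
      refine ⟨(Nat.floor_eq_iff (by positivity)).2 ⟨h1, h2⟩, h0, ?_⟩
      by_contra! h
      nlinarith
  rw [unitUniform, Measure.restrict_apply' measurableSet_Ico, hset, Real.volume_Ico,
    ← sub_div, add_sub_cancel_left, one_div, ENNReal.ofReal_inv_of_pos hpow,
    ENNReal.ofReal_pow (by norm_num), ENNReal.inv_pow]
  simp

/-- The natural number whose `n` binary digits, most significant first, are `f 0, …, f (n - 1)`. -/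
def leadingDigits (f : ℕ → ℕ) : ℕ → ℕ
  | 0 => 0
  | n + 1 => 2 * leadingDigits f n + f n

lemma leadingDigits_lt {f : ℕ → ℕ} {n : ℕ} (hf : ∀ i < n, f i < 2) : leadingDigits f n < 2 ^ n := by
  induction n with
  | zero => simp [leadingDigits]
  | succ n ih =>
    have := ih fun i hi => hf i (by lia)
    have := hf n (by lia)
    rw [leadingDigits, pow_succ]
    lia

lemma forall_bit_eq_iff {f : ℕ → ℕ} {n : ℕ} (hf : ∀ i < n, f i < 2) {u : ℝ}
    (hu : u ∈ Set.Ico (0 : ℝ) 1) :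
    (∀ i < n, bit i u = f i) ↔ ⌊u * 2 ^ n⌋₊ = leadingDigits f n := by
  induction n with
  | zero => simpa [leadingDigits] using hu.2
  | succ n ih =>
    have hn := hf n (by lia)
    rw [Nat.forall_lt_succ_right, ih fun i hi => hf i (by lia), bit_eq_natFloor,
      ← natFloor_mul_two_pow_div_two, leadingDigits]
    lia

lemma unitUniform_forall_bit_eq (f : ℕ → ℕ) (n : ℕ) :
    unitUniform {u | ∀ i < n, bit i u = f i} = ∏ i ∈ Finset.range n, fairCoin {f i} := by
  simp_rw [fairCoin_singleton]
  by_cases hf : ∀ i < n, f i < 2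
  · rw [Finset.prod_congr rfl fun i hi => if_pos (hf i (Finset.mem_range.1 hi)),
      Finset.prod_const, Finset.card_range, ← unitUniform_natFloor_eq (leadingDigits_lt hf)]
    refine measure_congr ?_
    filter_upwards [ae_restrict_mem measurableSet_Ico] with u hu
    exact propext (forall_bit_eq_iff hf hu)
  · push Not at hf
    obtain ⟨i, hi, hfi⟩ := hf
    rw [Finset.prod_eq_zero (Finset.mem_range.2 hi) (if_neg (by lia))]
    have : {u | ∀ i < n, bit i u = f i} = ∅ := by
      refine Set.eq_empty_of_forall_notMem fun u hu => ?_
      have := hu i hi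
      rw [bit_eq_natFloor] at this
      lia
    rw [this, measure_empty]

lemma map_bit_eq_infinitePi :
    unitUniform.map (fun u k => bit k u) = Measure.infinitePi fun _ : ℕ => fairCoin := by
  have hmeas : Measurable fun (u : ℝ) k => bit k u := measurable_pi_lambda _ measurable_bit
  refine IsProjectiveLimit.unique ?_
    (Measure.isProjectiveLimit_infinitePi fun _ : ℕ => fairCoin)
  refine (isProjectiveLimit_nat_iff
    (isProjectiveMeasureFamily_pi fun _ : ℕ => fairCoin) _).2 fun n => ?_
  rw [Measure.map_map (by fun_prop) hmeas]
  refine Measure.ext_of_singleton fun x => ?_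
  rw [Measure.pi_singleton, Measure.map_apply ((by fun_prop : Measurable _).comp hmeas)
    (measurableSet_singleton x)]
  let f : ℕ → ℕ := fun i => if h : i ∈ Finset.Iic n then x ⟨i, h⟩ else 0
  have hf (i : Finset.Iic n) : x i = f i := by simp only [f]; rw [dif_pos i.2]
  have hset : (Preorder.frestrictLe n ∘ fun u k => bit k u) ⁻¹' {x}
      = {u | ∀ i < n + 1, bit i u = f i} := by
    ext u
    simp only [Set.mem_preimage, Set.mem_singleton_iff, funext_iff, hf, Set.mem_ofPred_eq,
      Subtype.forall, Finset.mem_Iic, Nat.lt_succ_iff]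
    rfl
  rw [hset, unitUniform_forall_bit_eq]
  simp_rw [hf]
  rw [Finset.prod_coe_sort (Finset.Iic n) fun i => fairCoin {f i}]
  refine Finset.prod_congr ?_ fun _ _ => rfl
  ext i
  simp

lemma map_bit (k : ℕ) : unitUniform.map (bit k) = fairCoin := by
  have h := Measure.infinitePi_map_eval (fun _ : ℕ => fairCoin) k
  rwa [← map_bit_eq_infinitePi, Measure.map_map (by fun_prop)
    (measurable_pi_lambda _ measurable_bit)] at h

lemma iIndepFun_bit : iIndepFun bit unitUniform := by
  rw [iIndepFun_iff_map_fun_eq_infinitePi_map measurable_bit, map_bit_eq_infinitePi]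
  simp_rw [map_bit]

lemma map_bit_comp_eq_infinitePi {g : ℕ → ℕ} (hg : g.Injective) :
    unitUniform.map (fun u k => bit (g k) u) = Measure.infinitePi fun _ : ℕ => fairCoin := by
  rw [(iIndepFun_bit.precomp hg).map_fun_eq_infinitePi_map fun k => measurable_bit (g k)]
  simp_rw [map_bit]

/-! ### The slices of a uniform variable are i.i.d. uniform -/

/-- The real number with the given binary digits. -/
noncomputable def binarySum (d : ℕ → ℕ) : ℝ := ∑' k : ℕ, (d k : ℝ) / 2 ^ (k + 1)

lemma measurable_binarySum : Measurable binarySum := by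
  have h : binarySum = fun d => (∑' k : ℕ, ENNReal.ofReal ((d k : ℝ) / 2 ^ (k + 1))).toReal := by
    funext d
    rw [ENNReal.tsum_toReal_eq fun _ => ENNReal.ofReal_ne_top, binarySum]
    exact tsum_congr fun k => (ENNReal.toReal_ofReal (by positivity)).symm
  rw [h]
  refine (Measurable.tsum fun k => ENNReal.measurable_ofReal.comp ?_).ennreal_toReal
  exact (measurable_from_nat (f := fun m : ℕ => (m : ℝ) / 2 ^ (k + 1))).comp (measurable_pi_apply k)

lemma binarySum_bit {u : ℝ} (hu : u ∈ Set.Ico (0 : ℝ) 1) : binarySum (fun k => bit k u) = u := by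
  refine HasSum.tsum_eq ?_
  convert Real.hasSum_ofDigitsTerm_digits u one_lt_two hu using 2 with k
  simp [Real.ofDigitsTerm, Real.digits, bit_eq_natFloor, div_eq_mul_inv]

lemma map_uSlice (i : ℕ) : unitUniform.map (uSlice i) = unitUniform := by
  have hinj : (Nat.pair i).Injective := fun a b h => (Nat.pair_eq_pair.1 h).2
  have hslice : unitUniform.map (uSlice i)
      = (unitUniform.map fun u k => bit (Nat.pair i k) u).map binarySum :=
    (Measure.map_map measurable_binarySum
      (measurable_pi_lambda _ fun k => measurable_bit _)).symm
  rw [hslice, map_bit_comp_eq_infinitePi hinj, ← map_bit_eq_infinitePi,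
    Measure.map_map measurable_binarySum (measurable_pi_lambda _ measurable_bit)]
  conv_rhs => rw [← Measure.map_id (μ := unitUniform)]
  refine Measure.map_congr ?_
  filter_upwards [ae_restrict_mem measurableSet_Ico] with u hu
  exact binarySum_bit hu

/-- The σ-algebra generated by the binary digits with index in `J`. -/
noncomputable abbrev bitSigma (J : Set ℕ) : MeasurableSpace ℝ :=
  ⨆ j ∈ J, MeasurableSpace.comap (bit j) ⊤

lemma bitSigma_mono {J J' : Set ℕ} (h : J ⊆ J') : bitSigma J ≤ bitSigma J' :=
  biSup_mono h

lemma bitSigma_le (J : Set ℕ) : bitSigma J ≤ (inferInstance : MeasurableSpace ℝ) :=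
  iSup₂_le fun j _ => (measurable_bit j).comap_le

lemma indep_bitSigma {J J' : Set ℕ} (h : Disjoint J J') :
    Indep (bitSigma J) (bitSigma J') unitUniform :=
  indep_iSup_of_disjoint (fun j => (measurable_bit j).comap_le) iIndepFun_bit.iIndep h

lemma measurable_uSlice_bitSigma (i : ℕ) :
    Measurable[bitSigma {j | j.unpair.1 = i}] (uSlice i) := by
  refine measurable_binarySum.comp (@measurable_pi_lambda _ _ _ (bitSigma _) _ _ fun k => ?_)
  refine Measurable.of_comap_le ?_
  exact le_biSup (fun j => MeasurableSpace.comap (bit j) ⊤)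
    (show Nat.pair i k ∈ {j : ℕ | j.unpair.1 = i} by simp)

/-! ### Inverse-CDF sampling -/

section Sampling

variable {σ : Type} [Fintype σ] [Nonempty σ]

lemma measurableSet_sample_eq (P : PMF σ) (s : σ) : MeasurableSet {u | sample P u = s} := by
  let threshold : ℝ → Fin (Fintype.card σ) → Prop := fun u j => u < cumul P ((j : ℕ) + 1)
  let select : (Fin (Fintype.card σ) → Prop) → σ := fun q =>
    (Fintype.equivFin σ).symm <|
      if h : (Finset.univ.filter q).Nonempty then (Finset.univ.filter q).min' h
      else ⟨0, Fintype.card_pos⟩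
  have hthreshold : Measurable threshold :=
    measurable_pi_lambda _ fun j => measurableSet_setOfPred.1 measurableSet_Iio
  have hsample : sample P = select ∘ threshold := by
    funext u
    simp only [sample, select, threshold, Function.comp]
  have : {u | sample P u = s} = threshold ⁻¹' (select ⁻¹' {s}) := by
    rw [hsample]; rfl
  rw [this]
  exact hthreshold (Set.toFinite _).measurableSet

omit [Nonempty σ] in
lemma cumul_zero (P : PMF σ) : cumul P 0 = 0 := by simp [cumul]

omit [Nonempty σ] in
lemma cumul_succ (P : PMF σ) (j : Fin (Fintype.card σ)) :
    cumul P ((j : ℕ) + 1) = cumul P j + (P ((Fintype.equivFin σ).symm j)).toReal := by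
  have : (Finset.univ.filter fun i : Fin (Fintype.card σ) => (i : ℕ) < j + 1)
      = insert j (Finset.univ.filter fun i : Fin (Fintype.card σ) => (i : ℕ) < j) := by
    ext i
    simp only [Finset.mem_filter_univ, Finset.mem_insert, Fin.ext_iff]
    lia
  rw [cumul, this, Finset.sum_insert (by simp), add_comm]
  rfl

omit [Nonempty σ] in
lemma cumul_mono (P : PMF σ) : Monotone (cumul P) := fun _ _ h =>
  Finset.sum_le_sum_of_subset_of_nonneg
    (Finset.monotone_filter_right _ fun _ _ hi => lt_of_lt_of_le hi h)
    fun _ _ _ => ENNReal.toReal_nonneg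

omit [Nonempty σ] in
lemma cumul_card (P : PMF σ) : cumul P (Fintype.card σ) = 1 := by
  have h : ∑ s, P s = 1 := by rw [← tsum_fintype (L := .unconditional _)]; exact P.tsum_coe
  rw [cumul, Finset.filter_true_of_mem fun i _ => i.2,
    (Fintype.equivFin σ).symm.sum_comp fun s => (P s).toReal,
    ← ENNReal.toReal_sum fun s _ => P.apply_ne_top s, h, ENNReal.toReal_one]

lemma sample_eq_iff (P : PMF σ) (s : σ) {u : ℝ} (hu : u ∈ Set.Ico (0 : ℝ) 1) :
    sample P u = s ↔ u ∈ Set.Ico (cumul P (Fintype.equivFin σ s))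
      (cumul P ((Fintype.equivFin σ s : ℕ) + 1)) := by
  have hne : (Finset.univ.filter fun j : Fin (Fintype.card σ) =>
      u < cumul P ((j : ℕ) + 1)).Nonempty := by
    have hpos : 0 < Fintype.card σ := Fintype.card_pos
    refine ⟨⟨Fintype.card σ - 1, by lia⟩, ?_⟩
    simp only [Finset.mem_filter_univ]
    rw [Nat.sub_add_cancel hpos, cumul_card]
    exact hu.2
  rw [sample, dif_pos hne, Equiv.symm_apply_eq, Finset.min'_eq_iff]
  generalize Fintype.equivFin σ s = j
  simp only [Finset.mem_filter_univ, Set.mem_Ico]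
  rw [and_comm]
  refine and_congr_left fun hj => ⟨fun h => ?_, fun h i hi => ?_⟩
  · by_contra! hlt
    obtain ⟨_ | j, hjlt⟩ := j
    · exact absurd hu.1 (not_le.2 (by simpa [cumul_zero] using hlt))
    · have := h ⟨j, by lia⟩ hlt
      simp at this
  · by_contra! hij
    exact absurd (hi.trans_le (cumul_mono P (Nat.succ_le_of_lt hij))) (not_lt.2 h)

lemma unitUniform_sample_eq (P : PMF σ) (s : σ) : unitUniform {u | sample P u = s} = P s := by
  set j := Fintype.equivFin σ s with hj
  have hset : {u | sample P u = s} ∩ Set.Ico 0 1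
      = Set.Ico (cumul P j) (cumul P ((j : ℕ) + 1)) := by
    ext u
    constructor
    · rintro ⟨h, hu⟩
      exact (sample_eq_iff P s hu).1 h
    · intro h
      have hu : u ∈ Set.Ico (0 : ℝ) 1 :=
        ⟨((cumul_zero P).ge.trans (cumul_mono P (Nat.zero_le j))).trans h.1,
          h.2.trans_le ((cumul_mono P (Nat.succ_le_of_lt j.2)).trans (cumul_card P).le)⟩
      exact ⟨(sample_eq_iff P s hu).2 h, hu⟩
  rw [unitUniform, Measure.restrict_apply' measurableSet_Ico, hset, Real.volume_Ico, cumul_succ,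
    add_sub_cancel_left, ENNReal.ofReal_toReal (P.apply_ne_top _), hj, Equiv.symm_apply_apply]

/-! ### First-hitting decomposition of the reachability probability -/

lemma measurableSet_simTraj_eq (P : σ → PMF σ) (init : σ) (n : ℕ) (s : σ) :
    MeasurableSet[bitSigma {j | j.unpair.1 < n}] {u | simTraj P init u n = s} := by
  induction n generalizing s with
  | zero => exact @MeasurableSet.const _ (bitSigma _) (init = s)
  | succ n ih =>
    have : {u | simTraj P init u (n + 1) = s}
        = ⋃ t, {u | simTraj P init u n = t} ∩ uSlice n ⁻¹' {v | sample (P t) v = s} := by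
      ext u
      simp [simTraj]
    rw [this]
    refine MeasurableSet.iUnion fun t => MeasurableSet.inter ?_ ?_
    · exact bitSigma_mono (fun j (hj : _ < n) => Nat.lt_succ_of_lt hj) _ (ih t)
    · exact bitSigma_mono (fun j (hj : _ = n) => Nat.lt_succ_of_le hj.le) _
        (measurable_uSlice_bitSigma n (measurableSet_sample_eq (P t) s))

/-- The probability of being at `s` at time `n` without having met `G` before. -/
noncomputable def avoidWeight (P : σ → PMF σ) (init : σ) (G : Set σ) : ℕ → σ → ℝ≥0∞
  | 0, s => if s = init then 1 else 0
  | n + 1, s => ∑ t, if t ∈ G then 0 else avoidWeight P init G n t * P t s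

omit [Nonempty σ] in
lemma avoidWeight_succ (P : σ → PMF σ) (init : σ) (G : Set σ) (n : ℕ) (s : σ) :
    avoidWeight P init G (n + 1) s
      = ∑ t, if t ∈ G then 0 else avoidWeight P init G n t * P t s := rfl

lemma unitUniform_simTraj_avoid (P : σ → PMF σ) (init : σ) (G : Set σ) (n : ℕ) (s : σ) :
    unitUniform {u | (∀ m < n, simTraj P init u m ∉ G) ∧ simTraj P init u n = s}
      = avoidWeight P init G n s := by
  induction n generalizing s with
  | zero =>
    by_cases h : s = init
    · simp [simTraj, avoidWeight, h]
    · simp [simTraj, avoidWeight, h, Ne.symm h]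
  | succ n ih =>
    let past : σ → Set ℝ := fun t =>
      {u | (∀ m < n, simTraj P init u m ∉ G) ∧ simTraj P init u n = t}
    let step : σ → Set ℝ := fun t => uSlice n ⁻¹' {v | sample (P t) v = s}
    have hpast (t : σ) : MeasurableSet[bitSigma {j | j.unpair.1 < n}] (past t) := by
      have : past t = (⋂ m, ⋂ (_ : m < n), ⋂ g ∈ G, {u | simTraj P init u m = g}ᶜ)
          ∩ {u | simTraj P init u n = t} := by
        ext u
        simp only [past, Set.mem_ofPred_eq, Set.mem_inter_iff, Set.mem_iInter, Set.mem_compl_iff]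
        exact and_congr_left fun _ =>
          ⟨fun h m hm g hg hgu => h m hm (hgu ▸ hg), fun h m hm hg => h m hm _ hg rfl⟩
      rw [this]
      refine MeasurableSet.inter (MeasurableSet.iInter fun m => MeasurableSet.iInter fun hm =>
        MeasurableSet.biInter G.to_countable fun g _ => MeasurableSet.compl ?_)
        (measurableSet_simTraj_eq P init n t)
      exact bitSigma_mono (fun j (hj : _ < m) => hj.trans hm) _
        (measurableSet_simTraj_eq P init m g)
    have hstep (t : σ) : MeasurableSet[bitSigma {j | j.unpair.1 = n}] (step t) :=
      measurable_uSlice_bitSigma n (measurableSet_sample_eq (P t) s)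
    have hindep := indep_bitSigma (J := {j | j.unpair.1 < n}) (J' := {j | j.unpair.1 = n})
      (Set.disjoint_left.2 fun j (h : _ < n) => h.ne)
    have hprob (t : σ) : unitUniform (step t) = P t s := by
      rw [← unitUniform_sample_eq (P t) s]
      conv_rhs => rw [← map_uSlice n]
      exact (Measure.map_apply ((measurable_uSlice_bitSigma n).mono (bitSigma_le _) le_rfl)
        (measurableSet_sample_eq (P t) s)).symm
    have hset : {u | (∀ m < n + 1, simTraj P init u m ∉ G) ∧ simTraj P init u (n + 1) = s}
        = ⋃ t ∈ Finset.univ.filter (· ∉ G), past t ∩ step t := by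
      ext u
      simp only [past, step, Nat.forall_lt_succ_right, simTraj, Set.mem_ofPred_eq, Set.mem_iUnion,
        Finset.mem_filter_univ, Set.mem_inter_iff, Set.mem_preimage, exists_prop]
      constructor
      · rintro ⟨⟨h1, h2⟩, h3⟩
        exact ⟨_, h2, ⟨h1, rfl⟩, h3⟩
      · rintro ⟨t, ht, ⟨h1, rfl⟩, h3⟩
        exact ⟨⟨h1, ht⟩, h3⟩
    rw [hset, measure_biUnion_finset]
    · rw [avoidWeight, Finset.sum_filter]
      refine Finset.sum_congr rfl fun t _ => ?_
      rw [ite_not, Indep_iff _ _ _ |>.1 hindep _ _ (hpast t) (hstep t), hprob, ih]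
    · intro t _ t' _ htt'
      exact Set.disjoint_left.2 fun u hu hu' => htt' (hu.1.2.symm.trans hu'.1.2)
    · exact fun t _ => (bitSigma_le _ _ (hpast t)).inter (bitSigma_le _ _ (hstep t))

theorem reachProb_eq_tsum_avoidWeight (P : σ → PMF σ) (init : σ) (G : Set σ) :
    reachProb P init G = ∑' n, ∑ s, if s ∈ G then avoidWeight P init G n s else 0 := by
  let : MeasurableSpace σ := ⊤
  have hX (n : ℕ) : Measurable fun u => simTraj P init u n :=
    measurable_to_countable' fun s => bitSigma_le _ _ (measurableSet_simTraj_eq P init n s)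
  have hG (n : ℕ) : MeasurableSet {u | simTraj P init u n ∈ G} :=
    hX n MeasurableSpace.measurableSet_top
  have hA (n : ℕ) : MeasurableSet {u | ∀ m < n, simTraj P init u m ∉ G} := by
    simp only [Set.ofPred_forall]
    exact MeasurableSet.iInter fun m => MeasurableSet.iInter fun _ => (hG m).compl
  have hreach : MeasurableSet {ω : ℕ → σ | ∃ n, ω n ∈ G} := by
    simp only [Set.ofPred_exists]
    exact MeasurableSet.iUnion fun n => measurable_pi_apply n MeasurableSpace.measurableSet_top
  have hmap : reachProb P init G = unitUniform {u | ∃ n, simTraj P init u n ∈ G} :=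
    Measure.map_apply (measurable_pi_lambda _ hX) hreach
  have hset : {u | ∃ n, simTraj P init u n ∈ G} = ⋃ n,
      {u | ∀ m < n, simTraj P init u m ∉ G} ∩ {u | simTraj P init u n ∈ G} := by
    ext u
    simp only [Set.mem_ofPred_eq, Set.mem_iUnion, Set.mem_inter_iff]
    exact ⟨fun h => ⟨Nat.find h, fun m hm => Nat.find_min h hm, Nat.find_spec h⟩,
      fun ⟨n, _, h⟩ => ⟨n, h⟩⟩
  rw [hmap, hset, measure_iUnion _ fun n => (hA n).inter (hG n)]
  · refine tsum_congr fun n => ?_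
    have hsplit : {u | ∀ m < n, simTraj P init u m ∉ G} ∩ {u | simTraj P init u n ∈ G}
        = ⋃ s ∈ Finset.univ.filter (· ∈ G),
          {u | (∀ m < n, simTraj P init u m ∉ G) ∧ simTraj P init u n = s} := by
      ext u
      simp [and_comm]
    rw [hsplit, measure_biUnion_finset, Finset.sum_filter]
    · simp_rw [unitUniform_simTraj_avoid]
    · intro t _ t' _ htt'
      exact Set.disjoint_left.2 fun u hu hu' => htt' (hu.2.symm.trans hu'.2)
    · exact fun s _ => (hA n).inter (hX n (measurableSet_singleton s))
  · intro n n' hnn'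
    refine Set.disjoint_left.2 fun u hu hu' => ?_
    rcases lt_or_gt_of_ne hnn' with h | h
    · exact hu'.1 n h hu.2
    · exact hu.1 n' h hu'.2

end Sampling

/-! ### The all-in-one chain is the chain `D_r` delayed by one step -/

lemma some_mem_liftedGoal [DecidableEq S] [DecidableEq K] (𝔇 : MCFamily S K) (G : Set S) (s : S)
    (r : Realz 𝔇) : some (s, r) ∈ liftedGoal 𝔇 G ↔ s ∈ G := by
  simp only [liftedGoal, Set.mem_ofPred_eq, Option.some.injEq, Prod.mk.injEq]
  exact ⟨fun ⟨_, hG, _, h, _⟩ => h ▸ hG, fun h => ⟨s, h, r, rfl, rfl⟩⟩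

lemma none_notMem_liftedGoal [DecidableEq S] [DecidableEq K] (𝔇 : MCFamily S K) (G : Set S) :
    none ∉ liftedGoal 𝔇 G := by
  simp [liftedGoal]

lemma allInOneTrans_some_apply_none [DecidableEq S] [DecidableEq K] (𝔇 : MCFamily S K)
    (r r' : Realz 𝔇) (s : S) : allInOneTrans 𝔇 r (some (s, r')) none = 0 := by
  simp [allInOneTrans, PMF.map_apply]

lemma allInOneTrans_some_apply_some [DecidableEq S] [DecidableEq K] (𝔇 : MCFamily S K)
    (r r' q : Realz 𝔇) (s t : S) : allInOneTrans 𝔇 r (some (s, r')) (some (t, q))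
      = if q = r' then familyTrans 𝔇 r'.val s t else 0 := by
  rw [allInOneTrans, PMF.map_apply, familyTrans]
  by_cases h : q = r'
  · subst h
    rw [if_pos rfl, tsum_eq_single t]
    · simp
    · intro t' ht'
      simp [ht'.symm]
  · simp [h]

lemma avoidWeight_allInOneTrans [DecidableEq S] [DecidableEq K] [Nonempty S] (𝔇 : MCFamily S K)
    (r : Realz 𝔇) (G : Set S) (n : ℕ) :
    avoidWeight (allInOneTrans 𝔇 r) none (liftedGoal 𝔇 G) (n + 1) none = 0 ∧
    ∀ (s : S) (q : Realz 𝔇),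
      avoidWeight (allInOneTrans 𝔇 r) none (liftedGoal 𝔇 G) (n + 1) (some (s, q))
        = if q = r then avoidWeight (familyTrans 𝔇 r.val) 𝔇.s0 G n s else 0 := by
  induction n with
  | zero =>
    constructor
    · simp [avoidWeight, Fintype.sum_option, none_notMem_liftedGoal, allInOneTrans]
    · intro s q
      by_cases hq : q = r <;>
        simp [avoidWeight, Fintype.sum_option, none_notMem_liftedGoal, allInOneTrans, hq]
  | succ n ih =>
    obtain ⟨ih_none, ih_some⟩ := ih
    constructor
    · rw [avoidWeight_succ, Fintype.sum_option]
      simp [Fintype.sum_prod_type, ih_none, allInOneTrans_some_apply_none]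
    · intro s q
      rw [avoidWeight_succ, Fintype.sum_option, avoidWeight_succ (familyTrans 𝔇 r.val)]
      simp only [Fintype.sum_prod_type, ih_none, ih_some, some_mem_liftedGoal,
        allInOneTrans_some_apply_some, zero_mul, ite_self, zero_add]
      by_cases hq : q = r
      · rw [if_pos hq]
        refine Finset.sum_congr rfl fun t _ => ?_
        by_cases ht : t ∈ G <;> simp [ht, hq]
      · rw [if_neg hq]
        refine Finset.sum_eq_zero fun t _ => Finset.sum_eq_zero fun p _ => ?_
        by_cases hp : p = r
        · subst hp
          simp [hq]
        · simp [hp]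

/-- In the all-in-one MDP, the memoryless deterministic scheduler selecting `a_r` at the
fresh initial state `none` induces an MC whose probability of reaching the lifted goal
set `{some (s, r') | s ∈ G, r' ∈ R^𝔇}` from `none` equals `Prob(D_r, ◇G)`. -/
theorem allInOne_scheduler_reach_eq [DecidableEq S] [DecidableEq K] [Nonempty S]
    (𝔇 : MCFamily S K) (r : Realz 𝔇) (G : Set S) :
    reachProb (allInOneTrans 𝔇 r) none (liftedGoal 𝔇 G)
      = reachProb (familyTrans 𝔇 r.val) 𝔇.s0 G := by
  rw [reachProb_eq_tsum_avoidWeight, reachProb_eq_tsum_avoidWeight,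
    tsum_eq_zero_add' ENNReal.summable]
  have h_init : ∑ x, (if x ∈ liftedGoal 𝔇 G then
      avoidWeight (allInOneTrans 𝔇 r) none (liftedGoal 𝔇 G) 0 x else 0) = 0 := by
    simp [Fintype.sum_option, none_notMem_liftedGoal, avoidWeight]
  rw [h_init, zero_add]
  refine tsum_congr fun n => ?_
  obtain ⟨h_none, h_some⟩ := avoidWeight_allInOneTrans 𝔇 r G n
  rw [Fintype.sum_option, Fintype.sum_prod_type]
  simp only [h_none, h_some, some_mem_liftedGoal, ite_self, zero_add]
  refine Finset.sum_congr rfl fun s _ => ?_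
  by_cases hs : s ∈ G <;> simp [hs]
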